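/- Let k > 2 be an integer and let I ⊆ ℝ be an open interval around 0. Let F, G : I → ℝ be real-analytic with F(x) = c₁x^k + o(x^k) and G(x) = c₂x^k + o(x^k) as x → 0, where c₁, c₂ ∈ ℝ \ {0} (so both tubes have finite type k at the origin). Let U ⊆ {(z,w) ∈ ℂ² : Re z ∈ I} be a connected open neighborhood of the origin and let Ψ : U → ℂ² be an injective holomorphic map with Ψ(0) = 0, Ψ(U) ⊆ {(z,w) : Re z ∈ I}, and Ψ(T_F ∩ U) ⊆ T_G. Then there exist a, c ∈ ℝ \ {0} and b ∈ ℝ such that Ψ(z,w) = (az + ibw, cw) for all (z,w) ∈ U; moreover G(ax − bF(x)) = cF(x) for all x in some neighborhood of 0 in ℝ. -/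

import Mathlib

noncomputable section

open Complex

/-- The tube hypersurface over the graph of `h` (over the interval `I`). -/
def Tube (I : Set ℝ) (h : ℝ → ℝ) : Set (ℂ × ℂ) :=
  {p : ℂ × ℂ | p.1.re ∈ I ∧ p.2.im = h p.1.re}

namespace TubeRigidity

open Filter Topology Asymptotics Metric Set

/-- A continuous function on a connected set whose composition with a nonconstant real-analytic
function is constant is itself constant. -/
lemma eq_of_comp_const {I : Set ℝ} (hI : IsPreconnected I) {H : ℝ → ℝ}
    (hH : AnalyticOnNhd ℝ H I) (hne : ∃ p ∈ I, ∃ q ∈ I, H p ≠ H q) {S : Set ℝ}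
    (hS : IsPreconnected S) {s : ℝ → ℝ} (hs : ContinuousOn s S) (hmaps : MapsTo s S I) {K : ℝ}
    (hK : ∀ x ∈ S, H (s x) = K) {x y : ℝ} (hx : x ∈ S) (hy : y ∈ S) : s x = s y := by
  wlog hlt : s x < s y generalizing x y
  · rcases lt_trichotomy (s x) (s y) with h | h | h
    · exact this hx hy h
    · exact h
    · exact (this hy hx h).symm
  exfalso
  have hsub : Icc (s x) (s y) ⊆ s '' S :=
    (hS.image s hs).Icc_subset (mem_image_of_mem s hx) (mem_image_of_mem s hy)
  have hmem : Ioo (s x) (s y) ∈ 𝓝 ((s x + s y) / 2) :=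
    Ioo_mem_nhds (by linarith) (by linarith)
  have hHK : ∀ t ∈ Ioo (s x) (s y), H t = K := by
    intro t ht
    obtain ⟨v, hv, rfl⟩ := hsub (Ioo_subset_Icc_self ht)
    exact hK v hv
  have hmid : (s x + s y) / 2 ∈ I := by
    obtain ⟨v, hv, hv'⟩ := hsub (⟨by linarith, by linarith⟩ : (s x + s y) / 2 ∈ Icc (s x) (s y))
    exact hv' ▸ hmaps hv
  have hconst : EqOn H (fun _ => K) I :=
    hH.eqOn_of_preconnected_of_eventuallyEq analyticOnNhd_const hI hmid
      (eventually_of_mem hmem hHK)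
  obtain ⟨p, hp, q, hq, hpq⟩ := hne
  exact hpq ((hconst hp).trans (hconst hq).symm)

/-- Identity theorem on a disc, for functions that agree along a segment of a line through `0`. -/
lemma eqOn_ball_of_eventually_eq_line {δ y₀ : ℝ} {v : ℂ} (hv : v ≠ 0) {p q : ℂ → ℂ}
    (hp : DifferentiableOn ℂ p (ball 0 δ)) (hq : DifferentiableOn ℂ q (ball 0 δ))
    (hy₀ : (y₀ : ℂ) * v ∈ ball 0 δ) (h : ∀ᶠ y : ℝ in 𝓝 y₀, p (y * v) = q (y * v)) :
    EqOn p q (ball 0 δ) := by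
  refine (hp.analyticOnNhd isOpen_ball).eqOn_of_preconnected_of_frequently_eq
    (hq.analyticOnNhd isOpen_ball) (convex_ball _ _).isPreconnected hy₀ ?_
  have hline : Tendsto (fun y : ℝ => (y : ℂ) * v) (𝓝[≠] y₀) (𝓝[≠] (y₀ * v)) := by
    refine tendsto_nhdsWithin_of_tendsto_nhds_of_eventually_within _ ?_ ?_
    · exact (Continuous.tendsto (by fun_prop) y₀).mono_left nhdsWithin_le_nhds
    · filter_upwards [self_mem_nhdsWithin] with y hy
      simpa [hv] using hy
  exact hline.frequently (h.filter_mono nhdsWithin_le_nhds).frequently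

lemma hasDerivAt_re {r : ℝ → ℂ} {r' : ℂ} {t : ℝ} (hr : HasDerivAt r r' t) :
    HasDerivAt (fun t => (r t).re) r'.re t :=
  Complex.reCLM.hasFDerivAt.comp_hasDerivAt t hr

lemma hasDerivAt_im {r : ℝ → ℂ} {r' : ℂ} {t : ℝ} (hr : HasDerivAt r r' t) :
    HasDerivAt (fun t => (r t).im) r'.im t :=
  Complex.imCLM.hasFDerivAt.comp_hasDerivAt t hr

lemma hasDerivAt_comp_line {r : ℂ → ℂ} {z₀ θ : ℂ} {t : ℝ}
    (hr : DifferentiableAt ℂ r (z₀ + t * θ)) :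
    HasDerivAt (fun t : ℝ => r (z₀ + t * θ)) (θ * deriv r (z₀ + t * θ)) t := by
  have hline : HasDerivAt (fun t : ℝ => z₀ + t * θ) θ t := by
    simpa using ((hasDerivAt_id (t : ℝ)).ofReal_comp.mul_const θ).const_add z₀
  exact hr.hasDerivAt.scomp t hline

lemma deriv_eq_zero_of_isLittleO_sq {H H' : ℝ → ℝ} {d : ℝ}
    (hH : ∀ᶠ t in 𝓝 0, HasDerivAt H (H' t) t) (hH' : HasDerivAt H' d 0)
    (ho : H =o[𝓝 0] fun t => t ^ 2) : H' 0 = 0 ∧ d = 0 := by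
  have hH0 : H 0 = 0 := by
    obtain ⟨c, hc⟩ := ho.isBigO.bound
    simpa using hc.self_of_nhds
  have hd0 : H' 0 = 0 := by
    refine hH.self_of_nhds.unique ?_
    rw [hasDerivAt_iff_isLittleO_nhds_zero]
    simp only [zero_add, hH0, sub_zero, smul_zero]
    refine ho.trans ?_
    simpa using isLittleO_pow_pow (𝕜 := ℝ) (one_lt_two)
  refine ⟨hd0, ?_⟩
  have hlim : Tendsto (fun t => H' t / (2 * t)) (𝓝[≠] 0) (𝓝 (d / 2)) := by
    have := (hasDerivAt_iff_tendsto_slope.1 hH').div_const 2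
    refine this.congr fun t => ?_
    simp [slope_def_field, hd0, div_div, mul_comm]
  have hle : 𝓝[≠] (0 : ℝ) ≤ 𝓝 0 := nhdsWithin_le_nhds
  have h2 : Tendsto (fun t => H t / t ^ 2) (𝓝[≠] 0) (𝓝 (d / 2)) := by
    refine HasDerivAt.lhopital_zero_nhdsNE (hle hH)
      (g' := fun t => 2 * t) (Eventually.of_forall fun t => by simpa using hasDerivAt_pow 2 t)
      ?_ ?_ ?_ hlim
    · filter_upwards [self_mem_nhdsWithin] with t ht
      simpa using ht
    · simpa [hH0] using hH.self_of_nhds.continuousAt.tendsto.mono_left hle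
    · exact (Continuous.tendsto' (by fun_prop) 0 0 (by simp)).mono_left hle
  have h0 : Tendsto (fun t => H t / t ^ 2) (𝓝[≠] 0) (𝓝 0) :=
    ho.tendsto_div_nhds_zero.mono_left hle
  linarith [tendsto_nhds_unique h2 h0]

/-- Second-order contact of a holomorphic curve with the hypersurface `Im w = G (Re z)`
along a real direction `θ`. -/
lemma second_order_contact {p q : ℂ → ℂ} {z₀ θ : ℂ} {G : ℝ → ℝ} (hp : AnalyticAt ℂ p z₀)
    (hq : AnalyticAt ℂ q z₀) (hG : AnalyticAt ℝ G (q z₀).re)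
    (ho : (fun t : ℝ => (p (z₀ + t * θ)).im - G (q (z₀ + t * θ)).re) =o[𝓝 0] fun t => t ^ 2) :
    (θ * deriv p z₀).im = deriv G (q z₀).re * (θ * deriv q z₀).re ∧
    (θ * (θ * deriv (deriv p) z₀)).im =
      deriv (deriv G) (q z₀).re * (θ * deriv q z₀).re ^ 2 +
        deriv G (q z₀).re * (θ * (θ * deriv (deriv q) z₀)).re := by
  have hcont : Tendsto (fun t : ℝ => z₀ + t * θ) (𝓝 0) (𝓝 z₀) :=
    Continuous.tendsto' (by fun_prop) _ _ (by simp)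
  have hre : ∀ {r : ℂ → ℂ} {t : ℝ}, AnalyticAt ℂ r (z₀ + t * θ) →
      HasDerivAt (fun t : ℝ => (r (z₀ + t * θ)).re) (θ * deriv r (z₀ + t * θ)).re t :=
    fun hr => hasDerivAt_re (hasDerivAt_comp_line hr.differentiableAt)
  have him : ∀ {r : ℂ → ℂ} {t : ℝ}, AnalyticAt ℂ r (z₀ + t * θ) →
      HasDerivAt (fun t : ℝ => (r (z₀ + t * θ)).im) (θ * deriv r (z₀ + t * θ)).im t :=
    fun hr => hasDerivAt_im (hasDerivAt_comp_line hr.differentiableAt)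
  have hθ : ∀ {r : ℂ → ℂ} {z : ℂ}, AnalyticAt ℂ r z → AnalyticAt ℂ (fun z => θ * r z) z :=
    fun hr => analyticAt_const.mul hr
  have hev : ∀ᶠ t : ℝ in 𝓝 0, HasDerivAt
      (fun t : ℝ => (p (z₀ + t * θ)).im - G (q (z₀ + t * θ)).re)
      ((θ * deriv p (z₀ + t * θ)).im -
        deriv G (q (z₀ + t * θ)).re * (θ * deriv q (z₀ + t * θ)).re) t := by
    have hqc : Tendsto (fun t : ℝ => (q (z₀ + t * θ)).re) (𝓝 0) (𝓝 (q z₀).re) :=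
      (Complex.continuous_re.tendsto _).comp (hq.continuousAt.tendsto.comp hcont)
    filter_upwards [hcont.eventually hp.eventually_analyticAt,
      hcont.eventually hq.eventually_analyticAt, hqc.eventually hG.eventually_analyticAt]
      with t h1 h2 h3
    exact (him h1).sub (h3.differentiableAt.hasDerivAt.comp t (hre h2))
  have hz : z₀ + ((0 : ℝ) : ℂ) * θ = z₀ := by simp
  have hG' : HasDerivAt (fun t : ℝ => deriv G (q (z₀ + t * θ)).re)
      (deriv (deriv G) (q z₀).re * (θ * deriv q z₀).re) 0 := by
    have h1 := hre (r := q) (t := 0) (by rwa [hz])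
    have h2 : HasDerivAt (deriv G) (deriv (deriv G) (q z₀).re)
        ((q (z₀ + ((0 : ℝ) : ℂ) * θ)).re) := by
      rw [hz]; exact hG.deriv.differentiableAt.hasDerivAt
    have := h2.comp 0 h1
    rwa [hz] at this
  have hp2 := him (r := fun z => θ * deriv p z) (t := 0) (by rw [hz]; exact hθ hp.deriv)
  have hq2 := hre (r := fun z => θ * deriv q z) (t := 0) (by rw [hz]; exact hθ hq.deriv)
  rw [hz, deriv_const_mul _ hp.deriv.differentiableAt] at hp2
  rw [hz, deriv_const_mul _ hq.deriv.differentiableAt] at hq2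
  obtain ⟨h1, h2⟩ := deriv_eq_zero_of_isLittleO_sq hev (hp2.sub (hG'.mul hq2)) ho
  rw [hz] at h1 h2
  constructor
  · linarith
  · linear_combination h2

/-- Contact to second order forces the Levi form of the target to vanish on the curve's velocity. -/
lemma levi_contact {p q : ℂ → ℂ} {z₀ : ℂ} {G : ℝ → ℝ} (hp : AnalyticAt ℂ p z₀)
    (hq : AnalyticAt ℂ q z₀) (hG : AnalyticAt ℝ G (q z₀).re)
    (ho : (fun t : ℝ => (p (z₀ + t)).im - G (q (z₀ + t)).re) =o[𝓝 0] fun t => t ^ 2)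
    (hoI : (fun t : ℝ => (p (z₀ + t * I)).im - G (q (z₀ + t * I)).re) =o[𝓝 0] fun t => t ^ 2) :
    deriv p z₀ = I * deriv G (q z₀).re * deriv q z₀ ∧
      (deriv (deriv G) (q z₀).re = 0 ∨ deriv q z₀ = 0) := by
  obtain ⟨h1, h2⟩ := second_order_contact (θ := 1) hp hq hG (by simpa using ho)
  obtain ⟨h3, h4⟩ := second_order_contact hp hq hG hoI
  simp only [one_mul, mul_im, mul_re, I_re, I_im, zero_mul, zero_sub, zero_add]
    at h1 h2 h3 h4
  constructor
  · apply Complex.ext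
    · simp; linarith
    · simp; linarith
  · rw [or_iff_not_imp_left]
    intro hne
    have h5 : deriv (deriv G) (q z₀).re * ((deriv q z₀).re ^ 2 + (deriv q z₀).im ^ 2) = 0 := by
      linear_combination -h2 - h4
    have h6 := (mul_eq_zero.1 h5).resolve_left hne
    apply Complex.ext
    · simp; nlinarith [sq_nonneg (deriv q z₀).re, sq_nonneg (deriv q z₀).im]
    · simp; nlinarith [sq_nonneg (deriv q z₀).re, sq_nonneg (deriv q z₀).im]

/-- A holomorphic map `(f, g)` on a bidisc sending the tube over `F` into the tube over `G`,
with the radii so small that the local properties of `F` and `G` needed below hold. -/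
structure LocalTubeMap (k : ℕ) (I : Set ℝ) (F G : ℝ → ℝ) (c₁ c₂ δ ε : ℝ)
    (f g : ℂ × ℂ → ℂ) : Prop where
  two_lt : 2 < k
  preconnected : IsPreconnected I
  analytic : AnalyticOnNhd ℝ G I
  nonconst : ∃ p ∈ I, ∃ q ∈ I, G p ≠ G q
  source_coeff_ne_zero : c₁ ≠ 0
  target_coeff_ne_zero : c₂ ≠ 0
  isLittleO_source : (fun x => F x - c₁ * x ^ k) =o[𝓝 0] fun x => x ^ k
  isLittleO_target : (fun x => G x - c₂ * x ^ k) =o[𝓝 0] fun x => x ^ k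
  delta_pos : 0 < δ
  eps_pos : 0 < ε
  continuousOn : ContinuousOn F (Ioo (-ε) ε)
  source_ne_zero : ∀ x, x ≠ 0 → |x| < ε → F x ≠ 0
  differentiableOn_fst : DifferentiableOn ℂ f (ball 0 δ ×ˢ ball 0 δ)
  differentiableOn_snd : DifferentiableOn ℂ g (ball 0 δ ×ˢ ball 0 δ)
  norm_fst_le : ∀ p ∈ ball (0 : ℂ) δ ×ˢ ball (0 : ℂ) δ, ‖f p‖ ≤ 1
  norm_snd_le : ∀ p ∈ ball (0 : ℂ) δ ×ˢ ball (0 : ℂ) δ, ‖g p‖ ≤ 1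
  re_mem : ∀ p ∈ ball (0 : ℂ) δ ×ˢ ball (0 : ℂ) δ, (f p).re ∈ I
  levi_ne_zero : ∀ p ∈ ball (0 : ℂ) δ ×ˢ ball (0 : ℂ) δ,
    deriv (deriv G) (f p).re = 0 → (f p).re = 0
  map_zero_fst : f (0, 0) = 0
  map_zero_snd : g (0, 0) = 0
  injOn : InjOn (fun p => (f p, g p)) (ball 0 δ ×ˢ ball 0 δ)
  fst_mem : ∀ x y : ℝ, |x| < ε → |y| < ε → (x : ℂ) + y * Complex.I ∈ ball 0 δ
  snd_mem : ∀ x u : ℝ, |x| < ε → |u| < ε → (u : ℂ) + F x * Complex.I ∈ ball 0 δ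
  tube : ∀ x y u : ℝ, |x| < ε → |y| < ε → |u| < ε →
    (g (x + y * Complex.I, u + F x * Complex.I)).im =
      G (f (x + y * Complex.I, u + F x * Complex.I)).re

lemma eventually_abs_lt {ε y : ℝ} (hy : |y| < ε) : ∀ᶠ x in 𝓝 y, |x| < ε :=
  continuous_abs.continuousAt.eventually_lt continuousAt_const hy

lemma eq_zero_of_isLittleO_pow {k : ℕ} (hk : k ≠ 0) {F : ℝ → ℝ} {c : ℝ}
    (h : (fun x => F x - c * x ^ k) =o[𝓝 0] fun x => x ^ k) : F 0 = 0 := by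
  obtain ⟨C, hC⟩ := h.isBigO.bound
  simpa [hk] using hC.self_of_nhds

lemma isBigO_pow_of_isLittleO {k : ℕ} {F : ℝ → ℝ} {c : ℝ}
    (h : (fun x => F x - c * x ^ k) =o[𝓝 0] fun x => x ^ k) : F =O[𝓝 0] fun x => x ^ k := by
  simpa using h.isBigO.add (isBigO_const_mul_self c (fun x : ℝ => x ^ k) (𝓝 0))

lemma hasDerivAt_zero_of_isLittleO_pow {k : ℕ} (hk : 1 < k) {F : ℝ → ℝ} {c : ℝ}
    (h : (fun x => F x - c * x ^ k) =o[𝓝 0] fun x => x ^ k) : HasDerivAt F 0 0 := by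
  rw [hasDerivAt_iff_isLittleO_nhds_zero]
  simp only [zero_add, eq_zero_of_isLittleO_pow (by omega) h, sub_zero, smul_zero]
  refine (isBigO_pow_of_isLittleO h).trans_isLittleO ?_
  simpa using isLittleO_pow_pow (𝕜 := ℝ) hk

namespace LocalTubeMap

variable {k : ℕ} {J : Set ℝ} {F G : ℝ → ℝ} {c₁ c₂ δ ε : ℝ} {f g : ℂ × ℂ → ℂ}

lemma source_zero (h : LocalTubeMap k J F G c₁ c₂ δ ε f g) : F 0 = 0 :=
  eq_zero_of_isLittleO_pow (by have := h.two_lt; omega) h.isLittleO_source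

lemma target_zero (h : LocalTubeMap k J F G c₁ c₂ δ ε f g) : G 0 = 0 :=
  eq_zero_of_isLittleO_pow (by have := h.two_lt; omega) h.isLittleO_target

lemma hasDerivAt_source (h : LocalTubeMap k J F G c₁ c₂ δ ε f g) : HasDerivAt F 0 0 :=
  hasDerivAt_zero_of_isLittleO_pow (by have := h.two_lt; omega) h.isLittleO_source

lemma zero_mem (h : LocalTubeMap k J F G c₁ c₂ δ ε f g) : (0 : ℂ) ∈ ball 0 δ :=
  mem_ball_self h.delta_pos

lemma ofReal_half_mem (h : LocalTubeMap k J F G c₁ c₂ δ ε f g) :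
    ((δ / 2 : ℝ) : ℂ) ∈ ball 0 δ := by
  have := h.delta_pos
  simpa [abs_of_pos this] using this

lemma ofReal_mem (h : LocalTubeMap k J F G c₁ c₂ δ ε f g) {u : ℝ} (hu : |u| < ε) :
    (u : ℂ) ∈ ball 0 δ := by
  simpa using h.fst_mem u 0 hu (by simpa using h.eps_pos)

lemma ofReal_mul_I_mem (h : LocalTubeMap k J F G c₁ c₂ δ ε f g) {y : ℝ} (hy : |y| < ε) :
    (y : ℂ) * I ∈ ball 0 δ := by
  simpa using h.fst_mem 0 y (by simpa using h.eps_pos) hy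

lemma tube_real (h : LocalTubeMap k J F G c₁ c₂ δ ε f g) {y u : ℝ} (hy : |y| < ε)
    (hu : |u| < ε) : (g (y * I, u)).im = G (f (y * I, u)).re := by
  simpa [h.source_zero] using h.tube 0 y u (by simpa using h.eps_pos) hy hu

lemma differentiableOn_left {φ : ℂ × ℂ → ℂ}
    (hφ : DifferentiableOn ℂ φ (ball 0 δ ×ˢ ball 0 δ)) {w : ℂ} (hw : w ∈ ball 0 δ) :
    DifferentiableOn ℂ (fun z => φ (z, w)) (ball 0 δ) :=
  hφ.comp (by fun_prop) fun _ hz => ⟨hz, hw⟩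

lemma differentiableOn_right {φ : ℂ × ℂ → ℂ}
    (hφ : DifferentiableOn ℂ φ (ball 0 δ ×ˢ ball 0 δ)) {z : ℂ} (hz : z ∈ ball 0 δ) :
    DifferentiableOn ℂ (fun w => φ (z, w)) (ball 0 δ) :=
  hφ.comp (by fun_prop) fun _ hw => ⟨hz, hw⟩

lemma eqOn_of_eq_ofReal (h : LocalTubeMap k J F G c₁ c₂ δ ε f g) {p q : ℂ → ℂ}
    (hp : DifferentiableOn ℂ p (ball 0 δ)) (hq : DifferentiableOn ℂ q (ball 0 δ))
    (hpq : ∀ u : ℝ, |u| < ε → p u = q u) : EqOn p q (ball 0 δ) := by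
  have h0 : |(0 : ℝ)| < ε := by simpa using h.eps_pos
  refine eqOn_ball_of_eventually_eq_line (y₀ := 0) one_ne_zero hp hq (by simpa using h.delta_pos) ?_
  filter_upwards [eventually_abs_lt h0] with u hu
  simpa using hpq u hu

lemma eqOn_of_eq_ofReal_mul_I (h : LocalTubeMap k J F G c₁ c₂ δ ε f g) {p q : ℂ → ℂ}
    (hp : DifferentiableOn ℂ p (ball 0 δ)) (hq : DifferentiableOn ℂ q (ball 0 δ))
    (hpq : ∀ y : ℝ, |y| < ε → p (y * I) = q (y * I)) : EqOn p q (ball 0 δ) := by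
  have h0 : |(0 : ℝ)| < ε := by simpa using h.eps_pos
  refine eqOn_ball_of_eventually_eq_line (y₀ := 0) I_ne_zero hp hq (by simpa using h.delta_pos) ?_
  filter_upwards [eventually_abs_lt h0] with u hu
  exact hpq u hu

lemma eqOn_affine_of_deriv_eq (h : LocalTubeMap k J F G c₁ c₂ δ ε f g) {p : ℂ → ℂ} {c : ℂ}
    (hp : DifferentiableOn ℂ p (ball 0 δ)) (hc : ∀ z ∈ ball (0 : ℂ) δ, deriv p z = c) :
    ∀ z ∈ ball (0 : ℂ) δ, p z = p 0 + c * z := by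
  refine isOpen_ball.eqOn_of_deriv_eq (convex_ball (0 : ℂ) δ).isPreconnected hp (by fun_prop) ?_
    h.zero_mem (by simp)
  intro z hz
  rw [hc z hz]
  simp

lemma isBigO_slice (h : LocalTubeMap k J F G c₁ c₂ δ ε f g) {φ : ℂ × ℂ → ℂ}
    (hφ : DifferentiableOn ℂ φ (ball 0 δ ×ˢ ball 0 δ))
    (hb : ∀ p ∈ ball (0 : ℂ) δ ×ˢ ball (0 : ℂ) δ, ‖φ p‖ ≤ 1) {y u : ℝ} (hy : |y| < ε)
    (hu : |u| < ε) :
    (fun x : ℝ => φ (x + y * I, u + F x * I) - φ (x + y * I, u)) =O[𝓝 0] F := by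
  have h0 : |(0 : ℝ)| < ε := by simpa using h.eps_pos
  have hu' := h.ofReal_mem hu
  have hr : 0 < δ - |u| := by simpa using hu'
  have hF : ∀ᶠ x in 𝓝 (0 : ℝ), |F x| < δ - |u| := by
    refine h.hasDerivAt_source.continuousAt.abs.eventually_lt continuousAt_const ?_
    simpa [h.source_zero] using hr
  refine IsBigO.of_bound (2 / (δ - |u|)) ?_
  filter_upwards [hF, eventually_abs_lt h0] with x hx hxε
  have hz := h.fst_mem x y hxε hy
  have hsub : ball (u : ℂ) (δ - |u|) ⊆ ball 0 δ := ball_subset_ball' (by simp)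
  have hmaps : MapsTo (fun w => φ (x + y * I, w)) (ball (u : ℂ) (δ - |u|))
      (closedBall (φ (x + y * I, u)) 2) := by
    intro w hw
    rw [mem_closedBall, dist_eq_norm]
    refine (norm_sub_le _ _).trans ?_
    linarith [hb (x + y * I, w) ⟨hz, hsub hw⟩, hb (x + y * I, (u : ℂ)) ⟨hz, hu'⟩]
  have := Complex.dist_le_div_mul_dist_of_mapsTo_ball
    (((differentiableOn_right hφ hz)).mono hsub) hmaps (z := u + F x * I) (by simpa using hx)
  simpa [dist_eq_norm] using this

lemma isLittleO_contact (h : LocalTubeMap k J F G c₁ c₂ δ ε f g) {y u : ℝ} (hy : |y| < ε)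
    (hu : |u| < ε) :
    (fun x : ℝ => (g (x + y * I, u)).im - G (f (x + y * I, u)).re) =o[𝓝 0] fun x => x ^ 2 := by
  have h0 : |(0 : ℝ)| < ε := by simpa using h.eps_pos
  have hF : F =o[𝓝 0] fun x => x ^ 2 :=
    (isBigO_pow_of_isLittleO h.isLittleO_source).trans_isLittleO (isLittleO_pow_pow h.two_lt)
  refine IsBigO.trans_isLittleO ?_ hF
  have hg := h.isBigO_slice h.differentiableOn_snd h.norm_snd_le hy hu
  have hf := h.isBigO_slice h.differentiableOn_fst h.norm_fst_le hy hu
  have hg' : (fun x : ℝ => (g (x + y * I, u + F x * I)).im - (g (x + y * I, u)).im) =O[𝓝 0] F :=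
    (IsBigO.of_bound' (Eventually.of_forall fun x => by
      rw [← sub_im]; exact abs_im_le_norm _)).trans hg
  have hf' : (fun x : ℝ => (f (x + y * I, u + F x * I)).re - (f (x + y * I, u)).re) =O[𝓝 0] F :=
    (IsBigO.of_bound' (Eventually.of_forall fun x => by
      rw [← sub_re]; exact abs_re_le_norm _)).trans hf
  have hmem : ((y : ℂ) * I, (u : ℂ)) ∈ ball (0 : ℂ) δ ×ˢ ball (0 : ℂ) δ :=
    ⟨h.ofReal_mul_I_mem hy, h.ofReal_mem hu⟩
  have hfc : ContinuousAt f (y * I, u) :=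
    (h.differentiableOn_fst.differentiableAt
      ((isOpen_ball.prod isOpen_ball).mem_nhds hmem)).continuousAt
  have hFc := h.hasDerivAt_source.continuousAt
  have ht1 : Tendsto (fun x : ℝ => (f (x + y * I, u + F x * I)).re) (𝓝 0)
      (𝓝 (f (y * I, u)).re) := by
    refine (Complex.continuous_re.tendsto _).comp (hfc.tendsto.comp ?_)
    have : ContinuousAt (fun x : ℝ => ((x : ℂ) + y * I, (u : ℂ) + F x * I)) 0 := by fun_prop
    simpa [ContinuousAt, h.source_zero] using this
  have ht2 : Tendsto (fun x : ℝ => (f (x + y * I, u)).re) (𝓝 0) (𝓝 (f (y * I, u)).re) := by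
    refine (Complex.continuous_re.tendsto _).comp (hfc.tendsto.comp ?_)
    exact Continuous.tendsto' (by fun_prop) _ _ (by simp)
  have hG := (h.analytic _ (h.re_mem _ hmem)).hasStrictFDerivAt.isBigO_sub.comp_tendsto
    (ht1.prodMk_nhds ht2)
  refine ((hG.trans hf').sub hg').congr' ?_ EventuallyEq.rfl
  filter_upwards [eventually_abs_lt h0] with x hx
  simp only [Function.comp, h.tube x y u hx hy hu]
  ring

/-- The Levi form of the target vanishes on the images of the slices `w = u` over `Re z = 0`. -/
lemma levi (h : LocalTubeMap k J F G c₁ c₂ δ ε f g) {y u : ℝ} (hy : |y| < ε) (hu : |u| < ε) :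
    deriv (fun z => g (z, u)) (y * I) =
      I * deriv G (f (y * I, u)).re * deriv (fun z => f (z, u)) (y * I) ∧
      ((f (y * I, u)).re = 0 ∨ deriv (fun z => f (z, u)) (y * I) = 0) := by
  have hy' := h.ofReal_mul_I_mem hy
  have hu' := h.ofReal_mem hu
  have hnhds := isOpen_ball.mem_nhds hy'
  have := levi_contact (G := G) ((differentiableOn_left h.differentiableOn_snd hu').analyticAt hnhds)
    ((differentiableOn_left h.differentiableOn_fst hu').analyticAt hnhds)
    (h.analytic _ (h.re_mem _ ⟨hy', hu'⟩))
    (by simpa only [add_comm] using h.isLittleO_contact hy hu) ?_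
  · exact ⟨this.1, this.2.imp_left (h.levi_ne_zero _ ⟨hy', hu'⟩)⟩
  · refine (isLittleO_zero _ _).congr' ?_ EventuallyEq.rfl
    have ht : Tendsto (fun t : ℝ => y + t) (𝓝 0) (𝓝 y) :=
      Continuous.tendsto' (by fun_prop) _ _ (by simp)
    filter_upwards [ht.eventually (eventually_abs_lt hy)] with t ht
    have := h.tube_real ht hu
    push_cast at this
    rw [← add_mul, this, sub_self]

/-- The Levi-degenerate set `{Re z = 0}` is mapped into `{Re z = 0}`. -/
lemma re_eq_zero (h : LocalTubeMap k J F G c₁ c₂ δ ε f g) {y u : ℝ} (hy : |y| < ε)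
    (hu : |u| < ε) : (f (y * I, u)).re = 0 := by
  by_contra hne
  have hu' := h.ofReal_mem hu
  have hy' := h.ofReal_mul_I_mem hy
  have hfd := differentiableOn_left h.differentiableOn_fst hu'
  have hgd := differentiableOn_left h.differentiableOn_snd hu'
  have hcont : ContinuousAt (fun t : ℝ => (f (t * I, u)).re) y := by
    have h1 : ContinuousAt (fun z => f (z, u)) (y * I) :=
      hfd.continuousOn.continuousAt (isOpen_ball.mem_nhds hy')
    exact Complex.continuous_re.continuousAt.comp
      (h1.comp (f := fun t : ℝ => (t : ℂ) * I) (by fun_prop))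
  have hf0 : ∀ᶠ t : ℝ in 𝓝 y, deriv (fun z => f (z, u)) (t * I) = 0 := by
    filter_upwards [hcont.eventually_ne hne, eventually_abs_lt hy] with t ht htε
    exact (h.levi htε hu).2.resolve_left ht
  have hg0 : ∀ᶠ t : ℝ in 𝓝 y, deriv (fun z => g (z, u)) (t * I) = 0 := by
    filter_upwards [hf0, eventually_abs_lt hy] with t ht htε
    rw [(h.levi htε hu).1, ht, mul_zero]
  have hz := h.ofReal_half_mem
  have hfz := h.eqOn_affine_of_deriv_eq hfd (eqOn_ball_of_eventually_eq_line I_ne_zero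
    (hfd.deriv isOpen_ball) (differentiableOn_const 0) hy' hf0) _ hz
  have hgz := h.eqOn_affine_of_deriv_eq hgd (eqOn_ball_of_eventually_eq_line I_ne_zero
    (hgd.deriv isOpen_ball) (differentiableOn_const 0) hy' hg0) _ hz
  have hmem : (((δ / 2 : ℝ) : ℂ), (u : ℂ)) ∈ ball (0 : ℂ) δ ×ˢ ball (0 : ℂ) δ := ⟨hz, hu'⟩
  have hmem0 : ((0 : ℂ), (u : ℂ)) ∈ ball (0 : ℂ) δ ×ˢ ball (0 : ℂ) δ := ⟨h.zero_mem, hu'⟩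
  have := h.injOn hmem hmem0 (Prod.ext (by simpa using hfz) (by simpa using hgz))
  simp [h.delta_pos.ne'] at this

lemma deriv_snd_eq_zero (h : LocalTubeMap k J F G c₁ c₂ δ ε f g) {y u : ℝ} (hy : |y| < ε)
    (hu : |u| < ε) : deriv (fun z => g (z, u)) (y * I) = 0 := by
  have hG : deriv G 0 = 0 :=
    (hasDerivAt_zero_of_isLittleO_pow (by have := h.two_lt; omega) h.isLittleO_target).deriv
  simp [(h.levi hy hu).1, h.re_eq_zero hy hu, hG]

lemma snd_eq (h : LocalTubeMap k J F G c₁ c₂ δ ε f g) {z w : ℂ} (hz : z ∈ ball 0 δ)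
    (hw : w ∈ ball 0 δ) : g (z, w) = g (0, w) := by
  refine h.eqOn_of_eq_ofReal (differentiableOn_right h.differentiableOn_snd hz)
    (differentiableOn_right h.differentiableOn_snd h.zero_mem) (fun u hu => ?_) hw
  have hgd := differentiableOn_left h.differentiableOn_snd (h.ofReal_mem hu)
  simpa using h.eqOn_affine_of_deriv_eq hgd (h.eqOn_of_eq_ofReal_mul_I (hgd.deriv isOpen_ball)
    (differentiableOn_const 0) fun y hy => h.deriv_snd_eq_zero hy hu) z hz

lemma snd_real (h : LocalTubeMap k J F G c₁ c₂ δ ε f g) {u : ℝ} (hu : |u| < ε) :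
    (g (0, u)).im = 0 := by
  have h0 : |(0 : ℝ)| < ε := by simpa using h.eps_pos
  have h1 := h.tube_real h0 hu
  rw [h.re_eq_zero h0 hu, h.target_zero] at h1
  simpa using h1

lemma deriv_snd_im (h : LocalTubeMap k J F G c₁ c₂ δ ε f g) {u : ℝ} (hu : |u| < ε) :
    (deriv (fun w => g (0, w)) u).im = 0 := by
  have hd : DifferentiableAt ℂ (fun w => g (0, w)) (0 + u * 1) := by
    simpa using (differentiableOn_right h.differentiableOn_snd h.zero_mem).differentiableAt
      (isOpen_ball.mem_nhds (h.ofReal_mem hu))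
  have h1 := hasDerivAt_im (hasDerivAt_comp_line hd)
  have h2 : HasDerivAt (fun t : ℝ => (g (0, 0 + (t : ℂ) * 1)).im) 0 u := by
    refine (hasDerivAt_const u (0 : ℝ)).congr_of_eventuallyEq ?_
    filter_upwards [eventually_abs_lt hu] with t ht
    simpa using h.snd_real ht
  simpa using h1.unique h2

lemma deriv_fst_im (h : LocalTubeMap k J F G c₁ c₂ δ ε f g) {y u : ℝ} (hy : |y| < ε)
    (hu : |u| < ε) : (deriv (fun z => f (z, u)) (y * I)).im = 0 := by
  have hd : DifferentiableAt ℂ (fun z => f (z, u)) (0 + y * I) := by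
    simpa using (differentiableOn_left h.differentiableOn_fst (h.ofReal_mem hu)).differentiableAt
      (isOpen_ball.mem_nhds (h.ofReal_mul_I_mem hy))
  have h1 := hasDerivAt_re (hasDerivAt_comp_line hd)
  have h2 : HasDerivAt (fun t : ℝ => (f (0 + (t : ℂ) * I, u)).re) 0 y := by
    refine (hasDerivAt_const y (0 : ℝ)).congr_of_eventuallyEq ?_
    filter_upwards [eventually_abs_lt hy] with t ht
    simpa using h.re_eq_zero ht hu
  simpa using h1.unique h2

lemma hasDerivAt_curve (h : LocalTubeMap k J F G c₁ c₂ δ ε f g) {y u : ℝ} (hy : |y| < ε)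
    (hu : |u| < ε) :
    HasDerivAt (fun x : ℝ => (f (x + y * I, u + F x * I)).re)
      (deriv (fun z => f (z, u)) (y * I)).re 0 := by
  have hmem : ((y : ℂ) * I, (u : ℂ)) ∈ ball (0 : ℂ) δ ×ˢ ball (0 : ℂ) δ :=
    ⟨h.ofReal_mul_I_mem hy, h.ofReal_mem hu⟩
  have hf := (h.differentiableOn_fst.differentiableAt
    ((isOpen_ball.prod isOpen_ball).mem_nhds hmem)).hasFDerivAt
  have hslice : HasDerivAt (fun z => f (z, u)) (fderiv ℂ f (y * I, u) (1, 0)) (y * I) :=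
    hf.comp_hasDerivAt (y * I : ℂ) ((hasDerivAt_id _).prodMk (hasDerivAt_const _ _))
  have hcurve : HasDerivAt (fun x : ℝ => ((x : ℂ) + y * I, (u : ℂ) + F x * I)) (1, 0) 0 := by
    refine HasDerivAt.prodMk ?_ ?_
    · simpa using (hasDerivAt_id (0 : ℝ)).ofReal_comp.add_const ((y : ℂ) * I)
    · simpa using (h.hasDerivAt_source.ofReal_comp.mul_const I).const_add (u : ℂ)
  have hf' : HasFDerivAt f ((fderiv ℂ f (y * I, u)).restrictScalars ℝ)
      (((0 : ℝ) : ℂ) + y * I, (u : ℂ) + F 0 * I) := by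
    simpa [h.source_zero] using hf.restrictScalars ℝ
  rw [hslice.deriv]
  have := hf'.comp_hasDerivAt (0 : ℝ) hcurve
  exact hasDerivAt_re this

/-- Comparison of the coefficients of `x ^ k` in the tube equation. -/
lemma leading_coeff (h : LocalTubeMap k J F G c₁ c₂ δ ε f g) {y u : ℝ} (hy : |y| < ε)
    (hu : |u| < ε) :
    (deriv (fun w => g (0, w)) u).re * c₁ = c₂ * (deriv (fun z => f (z, u)) (y * I)).re ^ k := by
  have h0 : |(0 : ℝ)| < ε := by simpa using h.eps_pos
  have hle : 𝓝[≠] (0 : ℝ) ≤ 𝓝 0 := nhdsWithin_le_nhds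
  set γ : ℂ → ℂ := fun w => g (0, w)
  set s : ℝ → ℝ := fun x => (f (x + y * I, u + F x * I)).re
  have hs : HasDerivAt s (deriv (fun z => f (z, u)) (y * I)).re 0 := h.hasDerivAt_curve hy hu
  set l := (deriv (fun z => f (z, u)) (y * I)).re
  have hs0 : s 0 = 0 := by simp [s, h.source_zero, h.re_eq_zero hy hu]
  have hsO : s =O[𝓝 0] fun x => x := by simpa [hs0] using hs.isBigO_sub
  have hst : Tendsto s (𝓝 0) (𝓝 0) := by simpa [hs0, ContinuousAt] using hs.continuousAt
  have hγ : HasDerivAt (fun t : ℝ => (γ (u + t * I)).im) (I * deriv γ u).im 0 := by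
    have hd : DifferentiableAt ℂ γ (u + ((0 : ℝ) : ℂ) * I) := by
      simpa using (differentiableOn_right h.differentiableOn_snd h.zero_mem).differentiableAt
        (isOpen_ball.mem_nhds (h.ofReal_mem hu))
    simpa using hasDerivAt_im (hasDerivAt_comp_line hd)
  have hFt : Tendsto (fun x => F x / x ^ k) (𝓝[≠] 0) (𝓝 c₁) := by
    have h1 := (h.isLittleO_source.tendsto_div_nhds_zero.mono_left hle).add_const c₁
    rw [zero_add] at h1
    refine h1.congr' ?_
    filter_upwards [self_mem_nhdsWithin] with x hx
    have : x ^ k ≠ 0 := pow_ne_zero _ hx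
    field_simp
    ring
  have hleft : Tendsto (fun x => (γ (u + F x * I)).im / x ^ k) (𝓝[≠] 0)
      (𝓝 ((deriv γ u).re * c₁)) := by
    rw [hasDerivAt_iff_isLittleO_nhds_zero] at hγ
    have hF0 : Tendsto F (𝓝 0) (𝓝 0) := by
      simpa [h.source_zero, ContinuousAt] using h.hasDerivAt_source.continuousAt
    have h1 := (hγ.comp_tendsto hF0).trans_isBigO (isBigO_pow_of_isLittleO h.isLittleO_source)
    have h2 := (h1.tendsto_div_nhds_zero.mono_left hle).add (hFt.const_mul (deriv γ u).re)
    rw [zero_add] at h2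
    have h3 : (γ u).im = 0 := h.snd_real hu
    refine h2.congr fun x => ?_
    simp [h3]
    ring
  have hright : Tendsto (fun x => G (s x) / x ^ k) (𝓝[≠] 0) (𝓝 (c₂ * l ^ k)) := by
    have h1 := (h.isLittleO_target.comp_tendsto hst).trans_isBigO (hsO.pow k)
    have hl : Tendsto (fun x => s x / x) (𝓝[≠] 0) (𝓝 l) := by
      refine (hasDerivAt_iff_tendsto_slope.1 hs).congr fun x => ?_
      simp [slope_def_field, hs0]
    have h2 := (h1.tendsto_div_nhds_zero.mono_left hle).add ((hl.pow k).const_mul c₂)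
    rw [zero_add] at h2
    refine h2.congr fun x => ?_
    simp [div_pow]
    ring
  refine tendsto_nhds_unique hleft (hright.congr' ?_)
  filter_upwards [hle (eventually_abs_lt h0), self_mem_nhdsWithin] with x hx _
  have hm := h.snd_mem x u hx hu
  simp only [s, γ]
  rw [← h.tube x y u hx hy hu, h.snd_eq (h.fst_mem x y hx hy) hm]

/-- The coefficient of `z` in `f`, which is affine in `z`. -/
def slope (δ : ℝ) (f : ℂ × ℂ → ℂ) (w : ℂ) : ℂ :=
  (f ((δ / 2 : ℝ), w) - f (0, w)) / (δ / 2 : ℝ)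

lemma differentiableOn_slope (h : LocalTubeMap k J F G c₁ c₂ δ ε f g) :
    DifferentiableOn ℂ (slope δ f) (ball 0 δ) :=
  ((differentiableOn_right h.differentiableOn_fst h.ofReal_half_mem).sub
    (differentiableOn_right h.differentiableOn_fst h.zero_mem)).div_const _

lemma fst_eq_of_real (h : LocalTubeMap k J F G c₁ c₂ δ ε f g) {u : ℝ} (hu : |u| < ε) :
    ∀ z ∈ ball (0 : ℂ) δ, f (z, u) = f (0, u) + deriv (fun z => f (z, u)) 0 * z := by
  have h0 : |(0 : ℝ)| < ε := by simpa using h.eps_pos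
  have hfd := differentiableOn_left h.differentiableOn_fst (h.ofReal_mem hu)
  have hfd' := hfd.deriv isOpen_ball
  refine h.eqOn_affine_of_deriv_eq hfd
    (h.eqOn_of_eq_ofReal_mul_I hfd' (differentiableOn_const _) fun y hy => ?_)
  have hk : k ≠ 0 := by have := h.two_lt; omega
  have hc₂ : c₂ ≠ 0 := h.target_coeff_ne_zero
  have hre : (deriv (fun z => f (z, u)) (y * I)).re =
      (deriv (fun z => f (z, u)) (((0 : ℝ) : ℂ) * I)).re := by
    refine eq_of_comp_const (I := univ) (H := fun t => t ^ k)
      (s := fun y => (deriv (fun z => f (z, u)) (y * I)).re) (S := Ioo (-ε) ε)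
      (K := (deriv (fun w => g (0, w)) u).re * c₁ / c₂) isPreconnected_univ ?_
      ⟨0, trivial, 1, trivial, by simp [hk]⟩ isPreconnected_Ioo ?_ (mapsTo_univ _ _) ?_
      (abs_lt.1 hy) (abs_lt.1 h0)
    · exact fun t _ => analyticAt_id.pow k
    · refine Complex.continuous_re.comp_continuousOn (hfd'.continuousOn.comp (by fun_prop) ?_)
      exact fun t ht => h.ofReal_mul_I_mem (abs_lt.2 ht)
    · intro t ht
      rw [h.leading_coeff (abs_lt.2 ht) hu]
      field_simp
  have him := h.deriv_fst_im hy hu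
  have him0 := h.deriv_fst_im h0 hu
  rw [← him0] at him
  simpa using Complex.ext hre him

lemma deriv_fst_eq_slope (h : LocalTubeMap k J F G c₁ c₂ δ ε f g) {u : ℝ} (hu : |u| < ε) :
    deriv (fun z => f (z, u)) 0 = slope δ f u := by
  have hδ : ((δ / 2 : ℝ) : ℂ) ≠ 0 := by
    exact_mod_cast (half_pos h.delta_pos).ne'
  rw [slope, h.fst_eq_of_real hu _ h.ofReal_half_mem, add_sub_cancel_left, mul_div_cancel_right₀ _ hδ]

lemma fst_eq (h : LocalTubeMap k J F G c₁ c₂ δ ε f g) {z w : ℂ} (hz : z ∈ ball 0 δ)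
    (hw : w ∈ ball 0 δ) : f (z, w) = f (0, w) + slope δ f w * z := by
  refine h.eqOn_of_eq_ofReal (differentiableOn_right h.differentiableOn_fst hz)
    ((differentiableOn_right h.differentiableOn_fst h.zero_mem).add
      (h.differentiableOn_slope.mul_const z)) (fun u hu => ?_) hw
  rw [h.fst_eq_of_real hu z hz, h.deriv_fst_eq_slope hu]
  rfl

lemma re_fst (h : LocalTubeMap k J F G c₁ c₂ δ ε f g) {x y : ℝ} {w : ℂ} (hx : |x| < ε)
    (hy : |y| < ε) (hw : w ∈ ball 0 δ) :
    (f (x + y * I, w)).re = (f (0, w)).re + (slope δ f w).re * x - (slope δ f w).im * y := by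
  rw [h.fst_eq (h.fst_mem x y hx hy) hw]
  simp
  ring

lemma slope_im (h : LocalTubeMap k J F G c₁ c₂ δ ε f g) {x u : ℝ} (hx : |x| < ε) (hu : |u| < ε) :
    (slope δ f (u + F x * I)).im = 0 := by
  have hε := h.eps_pos
  have h0 : |(0 : ℝ)| < ε := by simpa using hε
  have hε2 : |ε / 2| < ε := by rw [abs_of_pos] <;> linarith
  have hw := h.snd_mem x u hx hu
  have key : (f (x + ((0 : ℝ) : ℂ) * I, u + F x * I)).re =
      (f (x + ((ε / 2 : ℝ) : ℂ) * I, u + F x * I)).re := by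
    refine eq_of_comp_const h.preconnected h.analytic h.nonconst (S := Ioo (-ε) ε)
      (s := fun y => (f (x + y * I, u + F x * I)).re) (K := (g (0, u + F x * I)).im)
      isPreconnected_Ioo ?_ ?_ ?_ (abs_lt.1 h0) (abs_lt.1 hε2)
    · refine Complex.continuous_re.comp_continuousOn
        ((differentiableOn_left h.differentiableOn_fst hw).continuousOn.comp (by fun_prop) ?_)
      exact fun t ht => h.fst_mem x t hx (abs_lt.2 ht)
    · exact fun t ht => h.re_mem _ ⟨h.fst_mem x t hx (abs_lt.2 ht), hw⟩
    · intro t ht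
      rw [← h.tube x t u hx (abs_lt.2 ht) hu, h.snd_eq (h.fst_mem x t hx (abs_lt.2 ht)) hw]
  rw [h.re_fst hx h0 hw, h.re_fst hx hε2 hw] at key
  have : (slope δ f (u + F x * I)).im * (ε / 2) = 0 := by linarith
  exact (mul_eq_zero.1 this).resolve_right (by linarith)

/-- The values of `w` on the tube over `F` fill an open set near the origin. -/
lemma exists_open_subset (h : LocalTubeMap k J F G c₁ c₂ δ ε f g) :
    ∃ V : Set ℂ, IsOpen V ∧ IsConnected V ∧ V ⊆ ball 0 δ ∧
      ∀ w ∈ V, ∃ x u : ℝ, |x| < ε ∧ |u| < ε ∧ w = u + F x * I := by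
  have hε := h.eps_pos
  have hε2 : |ε / 2| < ε := by rw [abs_of_pos] <;> linarith
  have hv : F (ε / 2) ≠ 0 := h.source_ne_zero _ (by linarith) hε2
  have hF : uIcc (F 0) (F (ε / 2)) ⊆ F '' uIcc 0 (ε / 2) := by
    refine intermediate_value_uIcc (h.continuousOn.mono fun t ht => ?_)
    rw [uIcc_of_le (by linarith)] at ht
    exact ⟨by linarith [ht.1], by linarith [ht.2]⟩
  rw [h.source_zero] at hF
  set m := min 0 (F (ε / 2))
  set M := max 0 (F (ε / 2))
  have hmM : m < M := min_lt_max.2 hv.symm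
  have hpar : ∀ w ∈ Ioo (-ε) ε ×ℂ Ioo m M, ∃ x u : ℝ, |x| < ε ∧ |u| < ε ∧ w = u + F x * I := by
    intro w hw
    rw [mem_reProdIm] at hw
    obtain ⟨x, hx, hxw⟩ := hF (Ioo_subset_Icc_self hw.2)
    rw [uIcc_of_le (by linarith)] at hx
    refine ⟨x, w.re, abs_lt.2 ⟨by linarith [hx.1], by linarith [hx.2]⟩, abs_lt.2 hw.1, ?_⟩
    rw [hxw, re_add_im]
  refine ⟨Ioo (-ε) ε ×ℂ Ioo m M, isOpen_Ioo.reProdIm isOpen_Ioo, ⟨?_, ?_⟩, ?_, hpar⟩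
  · refine ⟨⟨0, (m + M) / 2⟩, ?_⟩
    rw [mem_reProdIm]
    exact ⟨⟨by simpa using hε, by simpa using hε⟩, ⟨by simp only; linarith, by simp only; linarith⟩⟩
  · exact (((convex_Ioo _ _).linear_preimage reLm).inter
      ((convex_Ioo _ _).linear_preimage imLm)).isPreconnected
  · intro w hw
    obtain ⟨x, u, hx, hu, rfl⟩ := hpar w hw
    exact h.snd_mem x u hx hu

/-- A holomorphic function on the disc which is real for all `w` on the tube is a real constant. -/
lemma eq_ofReal_of_im_eq_zero (h : LocalTubeMap k J F G c₁ c₂ δ ε f g) {p : ℂ → ℂ}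
    (hp : DifferentiableOn ℂ p (ball 0 δ))
    (him : ∀ x u : ℝ, |x| < ε → |u| < ε → (p (u + F x * I)).im = 0) :
    ∃ a : ℝ, ∀ w ∈ ball (0 : ℂ) δ, p w = a := by
  obtain ⟨V, hVo, hVc, hVs, hV⟩ := h.exists_open_subset
  have hpa := hp.analyticOnNhd isOpen_ball
  obtain ⟨a, ha⟩ := (hpa.mono hVs).eq_const_add_im_mul_I_of_re_eq_const (c₀ := 0)
    (fun w hw => by
      obtain ⟨x, u, hx, hu, rfl⟩ := hV w hw
      exact him x u hx hu) hVo hVc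
  obtain ⟨w₀, hw₀⟩ := hVc.nonempty
  refine ⟨a, hpa.eqOn_of_preconnected_of_eventuallyEq analyticOnNhd_const
    (convex_ball _ _).isPreconnected (hVs hw₀) ?_⟩
  filter_upwards [hVo.mem_nhds hw₀] with w hw
  simpa using ha w hw

/-- The local form of the rigidity statement. -/
lemma exists_linear (h : LocalTubeMap k J F G c₁ c₂ δ ε f g) :
    ∃ a b c : ℝ, c * c₁ = c₂ * a ^ k ∧ ∀ z ∈ ball (0 : ℂ) δ, ∀ w ∈ ball (0 : ℂ) δ,
      f (z, w) = a * z + I * b * w ∧ g (z, w) = c * w := by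
  have hε := h.eps_pos
  have h0 : |(0 : ℝ)| < ε := by simpa using hε
  have hγd := differentiableOn_right h.differentiableOn_snd h.zero_mem
  have hBd := differentiableOn_right h.differentiableOn_fst h.zero_mem
  have hBd' := hBd.deriv isOpen_ball
  obtain ⟨a, ha⟩ := h.eq_ofReal_of_im_eq_zero h.differentiableOn_slope fun x u => h.slope_im
  have hγ : ∀ w ∈ ball (0 : ℂ) δ, deriv (fun w => g (0, w)) w = ((c₂ * a ^ k / c₁ : ℝ) : ℂ) := by
    refine h.eqOn_of_eq_ofReal (hγd.deriv isOpen_ball) (differentiableOn_const _) fun u hu => ?_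
    have h1 := h.leading_coeff h0 hu
    rw [ofReal_zero, zero_mul, h.deriv_fst_eq_slope hu, ha u (h.ofReal_mem hu), ofReal_re] at h1
    apply Complex.ext
    · rw [ofReal_re, eq_div_iff h.source_coeff_ne_zero, h1]
    · rw [ofReal_im, h.deriv_snd_im hu]
  have hBre : ∀ x u : ℝ, |x| < ε → |u| < ε →
      (f (0, u + F x * I)).re = (f (0, ((0 : ℝ) : ℂ) + F x * I)).re := by
    intro x u hx hu
    have key : (f (x + ((0 : ℝ) : ℂ) * I, u + F x * I)).re =
        (f (x + ((0 : ℝ) : ℂ) * I, ((0 : ℝ) : ℂ) + F x * I)).re := by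
      refine eq_of_comp_const h.preconnected h.analytic h.nonconst (S := Ioo (-ε) ε)
        (s := fun u => (f (x + ((0 : ℝ) : ℂ) * I, u + F x * I)).re) (K := c₂ * a ^ k / c₁ * F x)
        isPreconnected_Ioo ?_ ?_ ?_ (abs_lt.1 hu) (abs_lt.1 h0)
      · refine Complex.continuous_re.comp_continuousOn
          ((differentiableOn_right h.differentiableOn_fst
            (h.fst_mem x 0 hx h0)).continuousOn.comp (by fun_prop) ?_)
        exact fun t ht => h.snd_mem x t hx (abs_lt.2 ht)
      · exact fun t ht => h.re_mem _ ⟨h.fst_mem x 0 hx h0, h.snd_mem x t hx (abs_lt.2 ht)⟩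
      · intro t ht
        have hw := h.snd_mem x t hx (abs_lt.2 ht)
        rw [← h.tube x 0 t hx h0 (abs_lt.2 ht), h.snd_eq (h.fst_mem x 0 hx h0) hw,
          h.eqOn_affine_of_deriv_eq hγd hγ _ hw, h.map_zero_snd, zero_add, im_ofReal_mul]
        simp
    rw [h.re_fst hx h0 (h.snd_mem x u hx hu), h.re_fst hx h0 (h.snd_mem x 0 hx h0),
      ha _ (h.snd_mem x u hx hu), ha _ (h.snd_mem x 0 hx h0)] at key
    simpa using key
  obtain ⟨b, hb⟩ := h.eq_ofReal_of_im_eq_zero (p := fun w => -(I * deriv (fun w => f (0, w)) w))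
    (hBd'.const_mul I).neg fun x u hx hu => by
      have hd : DifferentiableAt ℂ (fun w => f (0, w)) (F x * I + u * 1) := by
        refine hBd.differentiableAt (isOpen_ball.mem_nhds ?_)
        simpa [add_comm] using h.snd_mem x u hx hu
      have h1 := hasDerivAt_re (hasDerivAt_comp_line hd)
      have h2 : HasDerivAt (fun t : ℝ => (f (0, F x * I + (t : ℂ) * 1)).re) 0 u := by
        refine (hasDerivAt_const u (f (0, ((0 : ℝ) : ℂ) + F x * I)).re).congr_of_eventuallyEq ?_
        filter_upwards [eventually_abs_lt hu] with t ht
        simpa [add_comm] using hBre x t hx ht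
      have := h1.unique h2
      simpa [add_comm] using this
  refine ⟨a, b, c₂ * a ^ k / c₁, div_mul_cancel₀ _ h.source_coeff_ne_zero, fun z hz w hw => ⟨?_, ?_⟩⟩
  · have hB := h.eqOn_affine_of_deriv_eq hBd (c := I * b) (fun w hw => by
      rw [← hb w hw, mul_neg, ← mul_assoc, I_mul_I]; ring) w hw
    rw [h.fst_eq hz hw, ha w hw, hB, h.map_zero_fst]
    ring
  · have hγ' := h.eqOn_affine_of_deriv_eq hγd hγ w hw
    rw [h.snd_eq hz hw, hγ', h.map_zero_snd, zero_add]

end LocalTubeMap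

lemma eventually_ne_zero_of_isLittleO_pow {k : ℕ} {F : ℝ → ℝ} {c : ℝ} (hc : c ≠ 0)
    (h : (fun x => F x - c * x ^ k) =o[𝓝 0] fun x => x ^ k) : ∀ᶠ x in 𝓝[≠] 0, F x ≠ 0 := by
  have hb := h.bound (half_pos (abs_pos.2 hc))
  filter_upwards [nhdsWithin_le_nhds hb, self_mem_nhdsWithin] with x hx hx0 hF
  have hpos : 0 < |x ^ k| := abs_pos.2 (pow_ne_zero _ hx0)
  rw [hF, zero_sub, norm_neg, norm_mul, Real.norm_eq_abs, Real.norm_eq_abs] at hx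
  nlinarith [mul_pos (abs_pos.2 hc) hpos]

/-- The second derivative of a function of finite type `k > 1` has an isolated zero, if any. -/
lemma eventually_deriv_deriv_ne_zero {k : ℕ} (hk : 1 < k) {G : ℝ → ℝ} {c : ℝ} (hc : c ≠ 0)
    (hG : AnalyticAt ℝ G 0)
    (h : (fun x => G x - c * x ^ k) =o[𝓝 0] fun x => x ^ k) :
    ∀ᶠ x in 𝓝[≠] 0, deriv (deriv G) x ≠ 0 := by
  refine hG.deriv.deriv.eventually_eq_zero_or_eventually_ne_zero.resolve_left fun h0 => ?_
  obtain ⟨r, hr, hball⟩ := Metric.eventually_nhds_iff_ball.1 (h0.and hG.eventually_analyticAt)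
  have hconn : IsPreconnected (ball (0 : ℝ) r) := (convex_ball _ _).isPreconnected
  have hmem : (0 : ℝ) ∈ ball 0 r := mem_ball_self hr
  have h1 : ∀ x ∈ ball (0 : ℝ) r, deriv G x = 0 := fun x hx => by
    rw [← (hasDerivAt_zero_of_isLittleO_pow hk h).deriv]
    exact isOpen_ball.is_const_of_deriv_eq_zero hconn
      (fun y hy => (hball y hy).2.deriv.differentiableAt.differentiableWithinAt)
      (fun y hy => (hball y hy).1) hx hmem
  have h2 : ∀ x ∈ ball (0 : ℝ) r, G x = 0 := fun x hx => by
    rw [← eq_zero_of_isLittleO_pow (by omega) h]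
    exact isOpen_ball.is_const_of_deriv_eq_zero hconn
      (fun y hy => (hball y hy).2.differentiableAt.differentiableWithinAt) h1 hx hmem
  have h3 : ∀ᶠ x in 𝓝[≠] (0 : ℝ), G x = 0 :=
    nhdsWithin_le_nhds (eventually_of_mem (ball_mem_nhds _ hr) h2)
  obtain ⟨x, hx, hx'⟩ := (h3.and (eventually_ne_zero_of_isLittleO_pow hc h)).exists
  exact hx' hx

/-- Identity theorem for holomorphic maps on a connected open subset of a complex normed space. -/
lemma eqOn_of_differentiableOn_of_eventuallyEq {E E' : Type*} [NormedAddCommGroup E]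
    [NormedSpace ℂ E] [NormedAddCommGroup E'] [NormedSpace ℂ E'] [CompleteSpace E']
    {U : Set E} (hU : IsOpen U) (hconn : IsPreconnected U) {φ ψ : E → E'}
    (hφ : DifferentiableOn ℂ φ U) (hψ : DifferentiableOn ℂ ψ U) {p₀ : E} (hp₀ : p₀ ∈ U)
    (h : φ =ᶠ[𝓝 p₀] ψ) : EqOn φ ψ U := by
  have hsub : U ⊆ {p | φ =ᶠ[𝓝 p] ψ} := by
    refine hconn.subset_of_closure_inter_subset isOpen_setOfPred_eventually_nhds ⟨p₀, hp₀, h⟩ ?_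
    rintro p ⟨hpc, hpU⟩
    obtain ⟨r, hr, hball⟩ := Metric.isOpen_iff.1 hU p hpU
    obtain ⟨q, hq, hqr⟩ := Metric.mem_closure_iff.1 hpc r hr
    refine eventually_of_mem (ball_mem_nhds p hr) fun x hx => ?_
    let L : ℂ → E := fun t => q + t • (x - q)
    have hLc : Continuous L := by fun_prop
    have hLd : Differentiable ℂ L := by fun_prop
    have hTo : IsOpen (L ⁻¹' ball p r) := isOpen_ball.preimage hLc
    have hTc : IsPreconnected (L ⁻¹' ball p r) := by
      refine Convex.isPreconnected fun t ht s hs a b ha hb hab => ?_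
      have : L (a • t + b • s) = a • L t + b • L s := by
        simp only [L, add_smul, smul_add, smul_assoc]
        have hq' : q = a • q + b • q := by rw [← add_smul, hab, one_smul]
        nth_rewrite 1 [hq']
        abel
      rw [mem_preimage, this]
      exact convex_ball p r ht hs ha hb hab
    have h0 : (0 : ℂ) ∈ L ⁻¹' ball p r := by simpa [L, dist_comm] using hqr
    have h1 : (1 : ℂ) ∈ L ⁻¹' ball p r := by simpa [L] using hx
    have han : ∀ {χ : E → E'}, DifferentiableOn ℂ χ U →
        AnalyticOnNhd ℂ (fun t => χ (L t)) (L ⁻¹' ball p r) := fun hχ =>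
      (hχ.comp hLd.differentiableOn fun t ht => hball ht).analyticOnNhd hTo
    have hL0 : Tendsto L (𝓝 0) (𝓝 q) := hLc.tendsto' 0 q (by simp [L])
    have := (han hφ).eqOn_of_preconnected_of_eventuallyEq (han hψ) hTc h0 (hL0.eventually hq) h1
    simpa [L] using this
  exact fun p hp => (hsub hp).self_of_nhds

/-- A map as in the theorem restricts to a `LocalTubeMap` on a small bidisc. -/
lemma exists_localTubeMap {k : ℕ} (hk : 2 < k) {α β : ℝ} (hα : α < 0) (hβ : 0 < β)
    {F G : ℝ → ℝ} (hF : AnalyticOnNhd ℝ F (Ioo α β)) (hG : AnalyticOnNhd ℝ G (Ioo α β))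
    {c₁ c₂ : ℝ} (hc₁ : c₁ ≠ 0) (hc₂ : c₂ ≠ 0)
    (hFk : (fun x => F x - c₁ * x ^ k) =o[𝓝 0] fun x => x ^ k)
    (hGk : (fun x => G x - c₂ * x ^ k) =o[𝓝 0] fun x => x ^ k)
    {U : Set (ℂ × ℂ)} (hU : IsOpen U) (hU0 : ((0 : ℂ), (0 : ℂ)) ∈ U)
    (hUI : ∀ p ∈ U, p.1.re ∈ Ioo α β)
    {Ψ : ℂ × ℂ → ℂ × ℂ} (hΨ : DifferentiableOn ℂ Ψ U) (hinj : InjOn Ψ U)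
    (hΨ0 : Ψ (0, 0) = (0, 0)) (hΨI : ∀ p ∈ U, (Ψ p).1.re ∈ Ioo α β)
    (htube : ∀ p ∈ U, p ∈ Tube (Ioo α β) F → Ψ p ∈ Tube (Ioo α β) G) :
    ∃ δ ε : ℝ, ball (0 : ℂ) δ ×ˢ ball (0 : ℂ) δ ⊆ U ∧
      LocalTubeMap k (Ioo α β) F G c₁ c₂ δ ε (fun p => (Ψ p).1) (fun p => (Ψ p).2) := by
  have hmem0 : (0 : ℝ) ∈ Ioo α β := ⟨hα, hβ⟩
  have hI0 : Ioo α β ∈ 𝓝 (0 : ℝ) := isOpen_Ioo.mem_nhds hmem0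
  have hF0 := eq_zero_of_isLittleO_pow (by omega) hFk
  have hG0 := eq_zero_of_isLittleO_pow (by omega) hGk
  obtain ⟨η, hη, hlevi⟩ := Metric.eventually_nhds_iff_ball.1 (eventually_nhdsWithin_iff.1
    (eventually_deriv_deriv_ne_zero (by omega) hc₂ (hG 0 hmem0) hGk))
  have hcont : Tendsto Ψ (𝓝 (0, 0)) (𝓝 0) := by
    have := hΨ.continuousOn.continuousAt (hU.mem_nhds hU0)
    rw [ContinuousAt, hΨ0] at this
    exact this
  obtain ⟨δ, hδ, hball⟩ := Metric.eventually_nhds_iff_ball.1 ((hU.eventually_mem hU0).and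
    (hcont.eventually (ball_mem_nhds 0 (lt_min one_pos hη))))
  rw [← ball_prod_same] at hball
  have hsub : ball (0 : ℂ) δ ×ˢ ball (0 : ℂ) δ ⊆ U := fun p hp => (hball p hp).1
  have hnorm : ∀ p ∈ ball (0 : ℂ) δ ×ˢ ball (0 : ℂ) δ, ‖Ψ p‖ < min 1 η := fun p hp => by
    simpa using (hball p hp).2
  have hFc : ContinuousAt F 0 := (hF 0 hmem0).continuousAt
  obtain ⟨r, hr, hrball⟩ := Metric.eventually_nhds_iff_ball.1
    ((eventually_mem_set.2 hI0).and ((hFc.abs.eventually_lt (g := fun _ => δ / 2)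
      continuousAt_const (by simpa [hF0] using hδ)).and (eventually_nhdsWithin_iff.1
      (eventually_ne_zero_of_isLittleO_pow hc₁ hFk))))
  have hr' : ∀ {x : ℝ}, |x| < min r (δ / 2) → x ∈ ball 0 r := fun hx => by
    simpa using hx.trans_le (min_le_left _ _)
  have hadd : ∀ {s t : ℝ}, |s| < δ / 2 → |t| < δ / 2 → (s : ℂ) + t * I ∈ ball 0 δ := by
    intro s t hs ht
    rw [mem_ball_zero_iff]
    refine (norm_add_le _ _).trans_lt ?_
    rw [norm_mul, norm_I, mul_one, norm_real, norm_real, Real.norm_eq_abs, Real.norm_eq_abs]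
    linarith
  have hfst : ∀ {x y : ℝ}, |x| < min r (δ / 2) → |y| < min r (δ / 2) →
      (x : ℂ) + y * I ∈ ball 0 δ := fun hx hy =>
    hadd (hx.trans_le (min_le_right _ _)) (hy.trans_le (min_le_right _ _))
  have hsnd : ∀ {x u : ℝ}, |x| < min r (δ / 2) → |u| < min r (δ / 2) →
      (u : ℂ) + F x * I ∈ ball 0 δ := fun hx hu =>
    hadd (hu.trans_le (min_le_right _ _)) (hrball _ (hr' hx)).2.1
  refine ⟨δ, min r (δ / 2), hsub, ?_⟩
  exact
    { two_lt := hk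
      preconnected := isPreconnected_Ioo
      analytic := hG
      nonconst := by
        obtain ⟨x, hx, hx'⟩ := ((eventually_ne_zero_of_isLittleO_pow hc₂ hGk).and
          (nhdsWithin_le_nhds hI0)).exists
        exact ⟨x, hx', 0, hmem0, by rwa [hG0]⟩
      source_coeff_ne_zero := hc₁
      target_coeff_ne_zero := hc₂
      isLittleO_source := hFk
      isLittleO_target := hGk
      delta_pos := hδ
      eps_pos := lt_min hr (half_pos hδ)
      continuousOn := fun x hx =>
        (hF x (hrball x (hr' (abs_lt.2 hx))).1).continuousAt.continuousWithinAt
      source_ne_zero := fun x hx0 hx => (hrball x (hr' hx)).2.2 hx0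
      differentiableOn_fst := differentiable_fst.comp_differentiableOn (hΨ.mono hsub)
      differentiableOn_snd := differentiable_snd.comp_differentiableOn (hΨ.mono hsub)
      norm_fst_le := fun p hp =>
        (norm_fst_le _).trans ((hnorm p hp).le.trans (min_le_left _ _))
      norm_snd_le := fun p hp =>
        (norm_snd_le _).trans ((hnorm p hp).le.trans (min_le_left _ _))
      re_mem := fun p hp => hΨI p (hsub hp)
      levi_ne_zero := fun p hp h0 => by
        by_contra hne
        refine hlevi _ ?_ hne h0
        rw [mem_ball_zero_iff, Real.norm_eq_abs]
        exact (abs_re_le_norm _).trans_lt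
          ((norm_fst_le _).trans_lt ((hnorm p hp).trans_le (min_le_right _ _)))
      map_zero_fst := by rw [hΨ0]
      map_zero_snd := by rw [hΨ0]
      injOn := hinj.mono hsub
      fst_mem := fun x y hx hy => hfst hx hy
      snd_mem := fun x u hx hu => hsnd hx hu
      tube := fun x y u hx hy hu => by
        have hp := hsub (mk_mem_prod (hfst hx hy) (hsnd hx hu))
        exact (htube _ hp ⟨hUI _ hp, by simp⟩).2 }

end TubeRigidity

/-- Proposition 5.1: a local biholomorphism fixing the origin and mapping the
tube over `F` to the tube over `G`, both of finite type `k > 2`, is of the form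
`(z,w) ↦ (az + ibw, cw)` with `a, c ∈ ℝ*`, `b ∈ ℝ`; moreover `G(ax − bF(x)) = cF(x)` near `0`. -/
theorem tube_biholomorphism_linear (k : ℕ) (hk : 2 < k)
    (I : Set ℝ) (α β : ℝ) (hα : α < 0) (hβ : 0 < β) (hI : I = Set.Ioo α β)
    (F G : ℝ → ℝ) (hF : AnalyticOnNhd ℝ F I) (hG : AnalyticOnNhd ℝ G I)
    (c₁ c₂ : ℝ) (hc₁ : c₁ ≠ 0) (hc₂ : c₂ ≠ 0)
    (hFk : (fun x => F x - c₁ * x ^ k) =o[nhds (0:ℝ)] fun x => x ^ k)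
    (hGk : (fun x => G x - c₂ * x ^ k) =o[nhds (0:ℝ)] fun x => x ^ k)
    (U : Set (ℂ × ℂ)) (hUopen : IsOpen U) (hUconn : IsConnected U)
    (hU0 : ((0 : ℂ), (0 : ℂ)) ∈ U) (hUI : ∀ p ∈ U, p.1.re ∈ I)
    (Ψ : ℂ × ℂ → ℂ × ℂ) (hΨhol : DifferentiableOn ℂ Ψ U) (hΨinj : Set.InjOn Ψ U)
    (hΨ0 : Ψ (0, 0) = (0, 0)) (hΨI : ∀ p ∈ U, (Ψ p).1.re ∈ I)
    (hΨtube : ∀ p ∈ U, p ∈ Tube I F → Ψ p ∈ Tube I G) :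
    ∃ a c : ℝ, a ≠ 0 ∧ c ≠ 0 ∧ ∃ b : ℝ,
      (∀ p ∈ U, Ψ p = ((a : ℂ) * p.1 + Complex.I * (b : ℂ) * p.2, (c : ℂ) * p.2)) ∧
      ∃ ε > (0:ℝ), ∀ x : ℝ, |x| < ε →
        a * x - b * F x ∈ I ∧ G (a * x - b * F x) = c * F x := by
  subst hI
  obtain ⟨δ, ε, hsub, h⟩ := TubeRigidity.exists_localTubeMap hk hα hβ hF hG hc₁ hc₂ hFk hGk
    hUopen hU0 hUI hΨhol hΨinj hΨ0 hΨI hΨtube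
  obtain ⟨a, b, c, hac, hlin⟩ := h.exists_linear
  have ha : a ≠ 0 := by
    rintro rfl
    have hmem : (((δ / 2 : ℝ) : ℂ), (0 : ℂ)) ∈ Metric.ball (0 : ℂ) δ ×ˢ Metric.ball (0 : ℂ) δ :=
      ⟨h.ofReal_half_mem, h.zero_mem⟩
    have hz := hlin _ h.ofReal_half_mem _ h.zero_mem
    have := hΨinj (hsub hmem) hU0 (by
      rw [hΨ0]; exact Prod.ext (hz.1.trans (by simp)) (hz.2.trans (by simp)))
    simp [h.delta_pos.ne'] at this
  have hc : c ≠ 0 := by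
    rintro rfl
    rw [zero_mul] at hac
    exact mul_ne_zero hc₂ (pow_ne_zero k ha) hac.symm
  refine ⟨a, c, ha, hc, b, ?_, ε, h.eps_pos, fun x hx => ?_⟩
  · refine TubeRigidity.eqOn_of_differentiableOn_of_eventuallyEq hUopen hUconn.isPreconnected
      hΨhol (by fun_prop) hU0 ?_
    filter_upwards [(Metric.isOpen_ball.prod Metric.isOpen_ball).mem_nhds
      (Set.mk_mem_prod h.zero_mem h.zero_mem)] with p hp
    exact Prod.ext (hlin _ hp.1 _ hp.2).1 (hlin _ hp.1 _ hp.2).2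
  · have h0 : |(0 : ℝ)| < ε := by simpa using h.eps_pos
    have hz := h.fst_mem x 0 hx h0
    have hw := h.snd_mem x 0 hx h0
    have hre : (Ψ (x + ((0 : ℝ) : ℂ) * Complex.I, ((0 : ℝ) : ℂ) + F x * Complex.I)).1.re =
        a * x - b * F x := by
      rw [(hlin _ hz _ hw).1]
      simp
      ring
    have him : (Ψ (x + ((0 : ℝ) : ℂ) * Complex.I, ((0 : ℝ) : ℂ) + F x * Complex.I)).2.im =
        c * F x := by
      rw [(hlin _ hz _ hw).2]
      simp
    rw [← hre, ← him]
    exact ⟨h.re_mem _ ⟨hz, hw⟩, (h.tube x 0 0 hx h0 h0).symm⟩
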